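/- For all real x with |x| ≤ 1/(6√3), cos((2/3)·arccos(6√3·x)) = 12·∑_{k≥0} S_k x^{2k+1} + 1/2 − 12·∑_{k≥1} T_k x^{2k}, where S_0 = 1/2, S_k = C(6k,3k)·C(3k,k)/(2(2k+1)·C(2k,k)) for k ≥ 1, and T_k = 16^k·C(3k,k)/(24(3k-1)). -/

import Mathlib

noncomputable def S (n : ℕ) : ℝ :=
  if n = 0 then 1 / 2 else
    (Nat.choose (6 * n) (3 * n) * Nat.choose (3 * n) n : ℝ)
      / (2 * (2 * n + 1) * Nat.choose (2 * n) n)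

noncomputable def T (n : ℕ) : ℝ :=
  16 ^ n * Nat.choose (3 * n) n / (24 * (3 * (n : ℝ) - 1))

/-- A power series with bounded coefficients may be differentiated termwise on `(-1, 1)`. -/
theorem hasDerivAt_tsum_pow_of_bounded {c : ℕ → ℝ} {C : ℝ} (hc : ∀ n, |c n| ≤ C) {u : ℝ}
    (hu : |u| < 1) :
    HasDerivAt (fun v => ∑' n, c n * v ^ n) (∑' n : ℕ, (n + 1 : ℝ) * c (n + 1) * u ^ n) u ∧
      Summable fun n : ℕ => (n + 1 : ℝ) * c (n + 1) * u ^ n := by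
  obtain ⟨r, hur, hr⟩ := exists_between hu
  have hr0 : 0 ≤ r := (abs_nonneg u).trans hur.le
  have hs : Summable fun n : ℕ => C * (n * r ^ (n - 1)) := by
    refine Summable.mul_left _ ((summable_nat_add_iff 1).1 ?_)
    have h1 := summable_pow_mul_geometric_of_norm_lt_one 1
      (by rwa [Real.norm_eq_abs, abs_of_nonneg hr0] : ‖r‖ < 1)
    have h0 := summable_geometric_of_lt_one hr0 hr
    refine (h1.add h0).congr fun n => ?_
    rw [Nat.add_sub_cancel]
    push_cast
    ring
  have hbound : ∀ n (y : ℝ), y ∈ Metric.ball (0 : ℝ) r →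
      ‖c n * (n * y ^ (n - 1))‖ ≤ C * (n * r ^ (n - 1)) := by
    intro n y hy
    rw [mem_ball_zero_iff, Real.norm_eq_abs] at hy
    rw [Real.norm_eq_abs, abs_mul, abs_mul, abs_pow, Nat.abs_cast]
    have hC : 0 ≤ C := (abs_nonneg _).trans (hc n)
    gcongr
    exact hc n
  have hu' : u ∈ Metric.ball (0 : ℝ) r := by
    rwa [mem_ball_zero_iff, Real.norm_eq_abs]
  have h0 : (0 : ℝ) ∈ Metric.ball (0 : ℝ) r :=
    Metric.mem_ball_self ((abs_nonneg u).trans_lt hur)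
  have hsum0 : Summable fun n => c n * (0 : ℝ) ^ n :=
    summable_of_ne_finset_zero (s := {0}) fun n hn => by
      rw [zero_pow (by simpa using hn), mul_zero]
  have hd := hasDerivAt_tsum_of_isPreconnected hs Metric.isOpen_ball
    (convex_ball (0 : ℝ) r).isPreconnected
    (fun n y _ => (hasDerivAt_pow n y).const_mul (c n)) hbound h0 hsum0 hu'
  have hsd : Summable fun n : ℕ => c n * (n * u ^ (n - 1)) :=
    Summable.of_norm_bounded hs fun n => hbound n u hu'
  have hshift : ∀ n : ℕ, c (n + 1) * (((n + 1 : ℕ) : ℝ) * u ^ (n + 1 - 1))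
      = (n + 1 : ℝ) * c (n + 1) * u ^ n := by
    intro n
    rw [Nat.add_sub_cancel]
    push_cast
    ring
  refine ⟨?_, ((summable_nat_add_iff 1).2 hsd).congr hshift⟩
  rw [hsd.tsum_eq_zero_add, tsum_congr hshift] at hd
  simpa using hd

/-- The Taylor coefficients at `0` of `u ↦ cos (2 / 3 * arccos u)`. -/
noncomputable def cosArccosCoeff : ℕ → ℝ
  | 0 => 1 / 2
  | 1 => √3 / 3
  | n + 2 => ((n : ℝ) ^ 2 - 4 / 9) / ((n + 1) * (n + 2)) * cosArccosCoeff n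

theorem cosArccosCoeff_add_two (n : ℕ) :
    ((n : ℝ) + 1) * (n + 2) * cosArccosCoeff (n + 2)
      = ((n : ℝ) ^ 2 - 4 / 9) * cosArccosCoeff n := by
  rw [cosArccosCoeff]
  field_simp

theorem abs_cosArccosCoeff_add_two {n : ℕ} (hn : 1 ≤ n) :
    ((n : ℝ) + 2) * |cosArccosCoeff (n + 2)|
      = n * |cosArccosCoeff n| - (n + 4 / 9) / (n + 1) * |cosArccosCoeff n| := by
  have hn' : (1 : ℝ) ≤ n := by exact_mod_cast hn
  have h := congrArg abs (cosArccosCoeff_add_two n)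
  rw [abs_mul, abs_mul (_ - _), abs_of_pos (by positivity : (0 : ℝ) < (n + 1) * (n + 2)),
    abs_of_nonneg (by nlinarith : (0 : ℝ) ≤ (n : ℝ) ^ 2 - 4 / 9)] at h
  field_simp
  linear_combination 9 * h

theorem sum_abs_cosArccosCoeff_le (N : ℕ) :
    ∑ n ∈ Finset.range N, |cosArccosCoeff (n + 1)|
      + 2 * ((N + 1) * |cosArccosCoeff (N + 1)| + (N + 2) * |cosArccosCoeff (N + 2)|)
      ≤ 2 * (|cosArccosCoeff 1| + 2 * |cosArccosCoeff 2|) := by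
  induction N with
  | zero => simp
  | succ N ih =>
    have h := abs_cosArccosCoeff_add_two (Nat.le_add_left 1 N)
    have hq : (1 : ℝ) / 2 ≤ (((N + 1 : ℕ) : ℝ) + 4 / 9) / ((N + 1 : ℕ) + 1) := by
      rw [div_le_div_iff₀ (by norm_num) (by positivity)]
      push_cast
      linarith [Nat.cast_nonneg (α := ℝ) N]
    have hm := mul_le_mul_of_nonneg_right hq (abs_nonneg (cosArccosCoeff (N + 1)))
    rw [Finset.sum_range_succ]
    push_cast at h hm ⊢
    simp only [add_assoc] at *
    norm_num at *
    nlinarith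

theorem summable_abs_cosArccosCoeff : Summable fun n => |cosArccosCoeff n| := by
  refine (summable_nat_add_iff 1).1
    (summable_of_sum_range_le (c := 2 * (|cosArccosCoeff 1| + 2 * |cosArccosCoeff 2|))
      (fun _ => abs_nonneg _) fun N => ?_)
  refine le_trans (le_add_of_nonneg_right ?_) (sum_abs_cosArccosCoeff_le N)
  positivity

theorem abs_succ_mul_cosArccosCoeff_le (n : ℕ) :
    |(n + 1 : ℝ) * cosArccosCoeff (n + 1)| ≤ |cosArccosCoeff 1| + 2 * |cosArccosCoeff 2| := by
  have h := sum_abs_cosArccosCoeff_le n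
  have h1 : 0 ≤ ∑ k ∈ Finset.range n, |cosArccosCoeff (k + 1)| :=
    Finset.sum_nonneg fun _ _ => abs_nonneg _
  have h2 : 0 ≤ ((n : ℝ) + 2) * |cosArccosCoeff (n + 2)| := by positivity
  rw [abs_mul, abs_of_nonneg (by positivity : (0 : ℝ) ≤ n + 1)]
  linarith

theorem summable_cosArccosCoeff_mul_pow {u : ℝ} (hu : |u| ≤ 1) :
    Summable fun n => cosArccosCoeff n * u ^ n := by
  refine Summable.of_norm_bounded summable_abs_cosArccosCoeff fun n => ?_
  rw [Real.norm_eq_abs, abs_mul, abs_pow]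
  exact mul_le_of_le_one_right (abs_nonneg _) (pow_le_one₀ (abs_nonneg u) hu)

/-- The power series `∑ cₙ uⁿ` and its first two derivatives on `(-1, 1)`, together with the
Chebyshev differential equation. -/
theorem exists_chebyshev_ode :
    ∃ F₁ F₂ : ℝ → ℝ, F₁ 0 = √3 / 3 ∧ ∀ u : ℝ, |u| < 1 →
      HasDerivAt (fun v => ∑' n, cosArccosCoeff n * v ^ n) (F₁ u) u ∧
      HasDerivAt F₁ (F₂ u) u ∧
      (1 - u ^ 2) * F₂ u = u * F₁ u - 4 / 9 * ∑' n, cosArccosCoeff n * u ^ n := by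
  refine ⟨fun u => ∑' n : ℕ, (n + 1 : ℝ) * cosArccosCoeff (n + 1) * u ^ n,
    fun u => ∑' n : ℕ, (n + 1 : ℝ) *
      (((n + 1 : ℕ) + 1 : ℝ) * cosArccosCoeff (n + 1 + 1)) * u ^ n, ?_, fun u hu => ?_⟩
  · dsimp only
    rw [tsum_eq_single 0 fun n hn => by rw [zero_pow hn, mul_zero]]
    simp [cosArccosCoeff]
  have hb : ∀ n, |cosArccosCoeff n| ≤ ∑' k, |cosArccosCoeff k| := fun n =>
    summable_abs_cosArccosCoeff.le_tsum n fun _ _ => abs_nonneg _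
  obtain ⟨hd₁, hs₁⟩ := hasDerivAt_tsum_pow_of_bounded hb hu
  obtain ⟨hd₂, hs₂⟩ := hasDerivAt_tsum_pow_of_bounded abs_succ_mul_cosArccosCoeff_le hu
  refine ⟨hd₁, hd₂, ?_⟩
  have hs₀ := summable_cosArccosCoeff_mul_pow hu.le
  have k₁ : HasSum (fun n : ℕ => (n : ℝ) * cosArccosCoeff n * u ^ n)
      (u * ∑' n : ℕ, (n + 1 : ℝ) * cosArccosCoeff (n + 1) * u ^ n) := by
    rw [← hasSum_nat_add_iff' 1]
    simp only [Finset.sum_range_one, Nat.cast_zero, zero_mul, sub_zero]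
    refine (hs₁.hasSum.mul_left u).congr_fun fun n => ?_
    push_cast
    ring
  have k₂ : HasSum (fun n : ℕ => (n : ℝ) * (n - 1) * cosArccosCoeff n * u ^ n)
      (u ^ 2 * ∑' n : ℕ, (n + 1 : ℝ) *
        (((n + 1 : ℕ) + 1 : ℝ) * cosArccosCoeff (n + 1 + 1)) * u ^ n) := by
    rw [← hasSum_nat_add_iff' 2]
    simp only [Finset.sum_range_succ, Finset.sum_range_zero, Nat.cast_zero, Nat.cast_one, zero_mul,
      sub_self, mul_zero, zero_add, sub_zero]
    refine (hs₂.hasSum.mul_left (u ^ 2)).congr_fun fun n => ?_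
    push_cast
    ring
  have k := (hs₂.hasSum.sub k₂).sub (k₁.sub (hs₀.hasSum.mul_left (4 / 9)))
  have hz : HasSum (fun _ : ℕ => (0 : ℝ)) _ := k.congr_fun fun n => by
    have h := cosArccosCoeff_add_two n
    push_cast
    linear_combination (-u ^ n) * h
  linear_combination hz.unique hasSum_zero

/-- The Taylor expansion of `cos (2 / 3 * arccos u)` on the open interval. -/
theorem tsum_cosArccosCoeff_cos {θ : ℝ} (hθ : θ ∈ Set.Ioo 0 Real.pi) :
    ∑' n, cosArccosCoeff n * Real.cos θ ^ n = Real.cos (2 / 3 * θ) := by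
  obtain ⟨F₁, F₂, hF₁, hF⟩ := exists_chebyshev_ode
  set F : ℝ → ℝ := fun v => ∑' n, cosArccosCoeff n * v ^ n with hFdef
  have hF0 : F 0 = 1 / 2 := by
    rw [hFdef]
    dsimp only
    rw [tsum_eq_single 0 fun n hn => by rw [zero_pow hn, mul_zero]]
    simp [cosArccosCoeff]
  let h : ℝ → ℝ := fun t => F (Real.cos t) - Real.cos (2 / 3 * t)
  let h₁ : ℝ → ℝ := fun t => F₁ (Real.cos t) * -Real.sin t + 2 / 3 * Real.sin (2 / 3 * t)
  have hcos : ∀ t ∈ Set.Ioo 0 Real.pi, |Real.cos t| < 1 := fun t ht => by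
    rw [← sq_lt_one_iff_abs_lt_one]
    nlinarith [Real.sin_sq_add_cos_sq t, Real.sin_pos_of_mem_Ioo ht]
  have hlin : ∀ t : ℝ, HasDerivAt (fun s : ℝ => 2 / 3 * s) (2 / 3) t := fun t => by
    simpa using (hasDerivAt_id t).const_mul (2 / 3 : ℝ)
  have hh : ∀ t ∈ Set.Ioo 0 Real.pi, HasDerivAt h (h₁ t) t := fun t ht => by
    have := ((hF _ (hcos t ht)).1.comp t (Real.hasDerivAt_cos t)).sub (hlin t).cos
    refine this.congr_deriv ?_
    simp only [h₁]
    ring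
  have hh₁ : ∀ t ∈ Set.Ioo 0 Real.pi, HasDerivAt h₁ (-(4 / 9) * h t) t := fun t ht => by
    obtain ⟨-, hd, hode⟩ := hF _ (hcos t ht)
    have := ((hd.comp t (Real.hasDerivAt_cos t)).mul (Real.hasDerivAt_sin t).neg).add
      ((hlin t).sin.const_mul (2 / 3))
    refine this.congr_deriv ?_
    simp only [h, Function.comp_apply, Pi.neg_apply, hFdef]
    linear_combination hode + F₂ (Real.cos t) * Real.sin_sq_add_cos_sq t
  have hE : ∀ t ∈ Set.Ioo 0 Real.pi,
      HasDerivAt (fun s => h₁ s ^ 2 + 4 / 9 * h s ^ 2) 0 t := fun t ht => by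
    refine (((hh₁ t ht).pow 2).add (((hh t ht).pow 2).const_mul (4 / 9))).congr_deriv ?_
    push_cast
    ring
  have hmid : Real.pi / 2 ∈ Set.Ioo 0 Real.pi := by
    constructor <;> linarith [Real.pi_pos]
  have hconst := isOpen_Ioo.is_const_of_deriv_eq_zero isPreconnected_Ioo
    (fun t ht => (hE t ht).differentiableAt.differentiableWithinAt)
    (fun t ht => (hE t ht).deriv) hθ hmid
  have e : 2 / 3 * (Real.pi / 2) = Real.pi / 3 := by ring
  have hmid₀ : h (Real.pi / 2) = 0 := by
    simp only [h, Real.cos_pi_div_two, hF0, e, Real.cos_pi_div_three, sub_self]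
  have hmid₁ : h₁ (Real.pi / 2) = 0 := by
    simp only [h₁, Real.cos_pi_div_two, Real.sin_pi_div_two, hF₁, e, Real.sin_pi_div_three]
    ring
  simp only [hmid₀, hmid₁] at hconst
  have : h θ = 0 := by nlinarith [sq_nonneg (h θ), sq_nonneg (h₁ θ)]
  exact sub_eq_zero.1 this

theorem tsum_cosArccosCoeff {u : ℝ} (hu : |u| ≤ 1) :
    ∑' n, cosArccosCoeff n * u ^ n = Real.cos (2 / 3 * Real.arccos u) := by
  have hc : ContinuousOn (fun v : ℝ => ∑' n, cosArccosCoeff n * v ^ n) (Set.Icc (-1) 1) := by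
    refine continuousOn_tsum (fun n => by fun_prop) summable_abs_cosArccosCoeff fun n v hv => ?_
    rw [Real.norm_eq_abs, abs_mul, abs_pow]
    exact mul_le_of_le_one_right (abs_nonneg _) (pow_le_one₀ (abs_nonneg v) (abs_le.2 hv))
  have heq : Set.EqOn (fun v : ℝ => ∑' n, cosArccosCoeff n * v ^ n)
      (fun v => Real.cos (2 / 3 * Real.arccos v)) (Set.Ioo (-1) 1) := fun v hv => by
    have := tsum_cosArccosCoeff_cos (θ := Real.arccos v)
      ⟨Real.arccos_pos.2 hv.2, Real.arccos_lt_pi.2 hv.1⟩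
    rwa [Real.cos_arccos hv.1.le hv.2.le] at this
  refine heq.of_subset_closure hc (Continuous.continuousOn ?_) Set.Ioo_subset_Icc_self ?_
    (abs_le.1 hu)
  · exact Real.continuous_cos.comp (continuous_const.mul Real.continuous_arccos)
  · rw [closure_Ioo (by norm_num)]

theorem six_sqrt_three_sq : (6 * √3) ^ 2 = 108 := by
  rw [mul_pow, Real.sq_sqrt (by norm_num)]
  norm_num

theorem T_eq_factorial (k : ℕ) :
    T k = 16 ^ k * (3 * k).factorial
      / (24 * (3 * (k : ℝ) - 1) * (k.factorial * (2 * k).factorial)) := by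
  rw [T, Nat.cast_choose ℝ (by omega : k ≤ 3 * k), show 3 * k - k = 2 * k by omega,
    mul_div_assoc', div_div, mul_comm (24 * _)]

theorem S_eq_factorial (k : ℕ) :
    S k = (6 * k).factorial * k.factorial
      / (2 * (2 * (k : ℝ) + 1) * (3 * k).factorial * (2 * k).factorial ^ 2) := by
  rcases Nat.eq_zero_or_pos k with rfl | hk
  · simp [S]
  rw [S, if_neg hk.ne', Nat.cast_choose ℝ (by omega : k ≤ 3 * k),
    Nat.cast_choose ℝ (by omega : k ≤ 2 * k), Nat.cast_choose ℝ (by omega : 3 * k ≤ 6 * k),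
    show 3 * k - k = 2 * k by omega, show 2 * k - k = k by omega,
    show 6 * k - 3 * k = 3 * k by omega]
  have h1 : ((k.factorial : ℕ) : ℝ) ≠ 0 := by positivity
  have h2 : (((2 * k).factorial : ℕ) : ℝ) ≠ 0 := by positivity
  have h3 : (((3 * k).factorial : ℕ) : ℝ) ≠ 0 := by positivity
  field_simp

theorem T_succ (k : ℕ) :
    (2 * (k : ℝ) + 1) * (2 * k + 2) * T (k + 1) = 48 * (3 * k - 1) * (3 * k + 1) * T k := by
  have h1 : (3 * (k : ℝ) - 1) ≠ 0 := fun h => by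
    have : 3 * k = 1 := by exact_mod_cast sub_eq_zero.1 h
    omega
  rw [T_eq_factorial, T_eq_factorial, show 3 * (k + 1) = 3 * k + 1 + 1 + 1 by ring,
    show 2 * (k + 1) = 2 * k + 1 + 1 by ring]
  simp only [Nat.factorial_succ]
  push_cast
  rw [show 3 * ((k : ℝ) + 1) - 1 = 3 * k + 2 by ring]
  generalize 3 * (k : ℝ) - 1 = d at *
  field_simp
  ring

theorem S_succ (k : ℕ) :
    (2 * (k : ℝ) + 2) * (2 * k + 3) * S (k + 1) = 12 * (6 * k + 1) * (6 * k + 5) * S k := by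
  rw [S_eq_factorial, S_eq_factorial, show 3 * (k + 1) = 3 * k + 1 + 1 + 1 by ring,
    show 2 * (k + 1) = 2 * k + 1 + 1 by ring,
    show 6 * (k + 1) = 6 * k + 1 + 1 + 1 + 1 + 1 + 1 by ring]
  simp only [Nat.factorial_succ]
  push_cast
  field_simp
  ring

theorem cosArccosCoeff_even (k : ℕ) :
    cosArccosCoeff (2 * k) * (6 * √3) ^ (2 * k) = -12 * T k := by
  induction k with
  | zero =>
    simp [cosArccosCoeff, T]
    norm_num
  | succ k ih =>
    have h := cosArccosCoeff_add_two (2 * k)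
    have hT := T_succ k
    push_cast at h
    have hpos : (0 : ℝ) < (2 * k + 1) * (2 * k + 2) := by positivity
    refine mul_left_cancel₀ hpos.ne' ?_
    rw [show 2 * (k + 1) = 2 * k + 2 by ring, pow_add, six_sqrt_three_sq]
    linear_combination (6 * √3) ^ (2 * k) * 108 * h + 12 * hT
      + 108 * ((2 * (k : ℝ)) ^ 2 - 4 / 9) * ih

theorem cosArccosCoeff_odd (k : ℕ) :
    cosArccosCoeff (2 * k + 1) * (6 * √3) ^ (2 * k + 1) = 12 * S k := by
  induction k with
  | zero =>
    have h3 : √3 * √3 = 3 := Real.mul_self_sqrt (by norm_num)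
    simp [cosArccosCoeff, S]
    linear_combination 2 * h3
  | succ k ih =>
    have h := cosArccosCoeff_add_two (2 * k + 1)
    have hS := S_succ k
    push_cast at h
    have hpos : (0 : ℝ) < (2 * k + 2) * (2 * k + 3) := by positivity
    refine mul_left_cancel₀ hpos.ne' ?_
    rw [show 2 * (k + 1) + 1 = 2 * k + 1 + 2 by ring, pow_add, six_sqrt_three_sq]
    linear_combination (6 * √3) ^ (2 * k + 1) * 108 * h - 12 * hS
      + 108 * ((2 * (k : ℝ) + 1) ^ 2 - 4 / 9) * ih

theorem sun_conjecture (x : ℝ) (hx : |x| ≤ 1 / (6 * Real.sqrt 3)) :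
    (Summable fun k : ℕ => S k * x ^ (2 * k + 1)) ∧
    (Summable fun k : ℕ => T (k + 1) * x ^ (2 * (k + 1))) ∧
    Real.cos ((2 / 3) * Real.arccos (6 * Real.sqrt 3 * x))
      = 12 * (∑' k : ℕ, S k * x ^ (2 * k + 1)) + 1 / 2
        - 12 * (∑' k : ℕ, T (k + 1) * x ^ (2 * (k + 1))) := by
  have hu : |6 * √3 * x| ≤ 1 := by
    rw [le_div_iff₀ (by positivity)] at hx
    rwa [abs_mul, abs_of_pos (by positivity : 0 < 6 * √3), mul_comm]
  have hs := summable_cosArccosCoeff_mul_pow hu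
  have he : ∀ k, cosArccosCoeff (2 * k) * (6 * √3 * x) ^ (2 * k) = -12 * (T k * x ^ (2 * k)) :=
    fun k => by rw [mul_pow, ← mul_assoc, cosArccosCoeff_even, mul_assoc]
  have ho : ∀ k, cosArccosCoeff (2 * k + 1) * (6 * √3 * x) ^ (2 * k + 1)
      = 12 * (S k * x ^ (2 * k + 1)) :=
    fun k => by rw [mul_pow, ← mul_assoc, cosArccosCoeff_odd, mul_assoc]
  have hse : Summable fun k => cosArccosCoeff (2 * k) * (6 * √3 * x) ^ (2 * k) :=
    hs.comp_injective (mul_right_injective₀ two_ne_zero)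
  have hso : Summable fun k => cosArccosCoeff (2 * k + 1) * (6 * √3 * x) ^ (2 * k + 1) :=
    hs.comp_injective ((add_left_injective 1).comp (mul_right_injective₀ two_ne_zero))
  have hsT : Summable fun k => T k * x ^ (2 * k) :=
    (summable_mul_left_iff (by norm_num : (-12 : ℝ) ≠ 0)).1 (by simpa only [he] using hse)
  have hsS : Summable fun k => S k * x ^ (2 * k + 1) :=
    (summable_mul_left_iff (by norm_num : (12 : ℝ) ≠ 0)).1 (by simpa only [ho] using hso)
  refine ⟨hsS, (summable_nat_add_iff 1).2 hsT, ?_⟩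
  have hT0 : T 0 = -1 / 24 := by norm_num [T]
  have hsplit := tsum_even_add_odd (f := fun n => cosArccosCoeff n * (6 * √3 * x) ^ n) hse hso
  simp only [he, ho] at hsplit
  rw [tsum_mul_left, tsum_mul_left, hsT.tsum_eq_zero_add, mul_zero, pow_zero, hT0] at hsplit
  rw [← tsum_cosArccosCoeff hu, ← hsplit]
  ring
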